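/- arXiv:1001.0875 — 2 statements merged into one kernel-verified Lean document; each statement's English description precedes it below -/
import Mathlib

section
/- There exists a universal constant C > 0 such that for any n ≥ 1, (1/n) sup_X E(|X|² − n)² ≤ C σ_n², where the supremum runs over all isotropic, log-concave random vectors X in ℝⁿ. -/
open MeasureTheory Real Set Filter Topology RealInnerProductSpace
noncomputable section

abbrev EucSp (n : ℕ) := EuclideanSpace ℝ (Fin n)

/-- A nonnegative function is log-concave. -/
def IsLogConcaveFn {n : ℕ} (f : EucSp n → ℝ) : Prop :=
  (∀ x, 0 ≤ f x) ∧ ∀ x y : EucSp n, ∀ l : ℝ, l ∈ Set.Icc (0:ℝ) 1 →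
    f x ^ (1 - l) * f y ^ l ≤ f ((1 - l) • x + l • y)

/-- A measure is log-concave if it has a log-concave density w.r.t. Lebesgue measure. -/
def IsLogConcave {n : ℕ} (μ : Measure (EucSp n)) : Prop :=
  ∃ f : EucSp n → ℝ, IsLogConcaveFn f ∧
    μ = volume.withDensity (fun x => ENNReal.ofReal (f x))

/-- Barycenter at the origin and covariance matrix equal to the identity. -/
def IsIsotropic {n : ℕ} (μ : Measure (EucSp n)) : Prop :=
  (∫ x, x ∂μ = 0) ∧ ∀ u v : EucSp n, (∫ x, ⟪x, u⟫ * ⟪x, v⟫ ∂μ) = ⟪u, v⟫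

/-- σ_n² = sup over isotropic log-concave random vectors of E (|X| - √n)². -/
def sigmaNSq (n : ℕ) : ℝ :=
  sSup {v | ∃ μ : Measure (EucSp n), IsProbabilityMeasure μ ∧ IsIsotropic μ ∧
    IsLogConcave μ ∧ v = ∫ x, (‖x‖ - Real.sqrt n) ^ 2 ∂μ}

def sigmaN (n : ℕ) : ℝ := Real.sqrt (sigmaNSq n)

/-- σ̲_n = (1/√n) sup over isotropic log-concave random vectors of |E X |X|²|. -/
def sigmaBar (n : ℕ) : ℝ :=
  (Real.sqrt n)⁻¹ * sSup {v | ∃ μ : Measure (EucSp n), IsProbabilityMeasure μ ∧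
    IsIsotropic μ ∧ IsLogConcave μ ∧ v = ‖∫ x, (‖x‖ ^ 2) • x ∂μ‖}

/-- L_n = sup over isotropic log-concave probability densities f on ℝⁿ of f(0)^{1/n}. -/
def LN (n : ℕ) : ℝ :=
  sSup {l | ∃ (μ : Measure (EucSp n)) (f : EucSp n → ℝ),
    IsProbabilityMeasure μ ∧ IsIsotropic μ ∧ IsLogConcaveFn f ∧
    μ = volume.withDensity (fun x => ENNReal.ofReal (f x)) ∧
    l = f 0 ^ ((n : ℝ)⁻¹)}

open scoped ENNReal

/-- The one-dimensional Brunn–Minkowski inequality for midpoint sums. -/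
lemma volume_add_le_of_midpoint_mem {A B D : Set ℝ} (hA : MeasurableSet A) (hB : MeasurableSet B)
    (hA0 : A.Nonempty) (hB0 : B.Nonempty)
    (h : ∀ x ∈ A, ∀ y ∈ B, (x + y) / 2 ∈ D) :
    volume A + volume B ≤ 2 * volume D := by
  have compact_case : ∀ K ⊆ A, IsCompact K → K.Nonempty → ∀ L ⊆ B, IsCompact L → L.Nonempty →
      volume K + volume L ≤ 2 * volume D := by
    intro K hKA hK hK0 L hLB hL hL0
    obtain ⟨a, haK, ha⟩ := hK.exists_isGreatest hK0
    obtain ⟨b, hbL, hb⟩ := hL.exists_isLeast hL0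
    have hdisj : AEDisjoint volume ((fun x => x + -b) ⁻¹' K) ((fun x => x + -a) ⁻¹' L) := by
      refine measure_mono_null (t := {a + b}) ?_ (by simp)
      rintro z ⟨hz1, hz2⟩
      have h1 := ha hz1
      have h2 := hb hz2
      simp only [mem_singleton_iff]
      linarith
    have hLm : MeasurableSet ((fun x => x + -a) ⁻¹' L) :=
      (measurable_add_const _) hL.measurableSet
    have hunion := measure_union₀ (μ := volume) hLm.nullMeasurableSet hdisj
    rw [measure_preimage_add_right, measure_preimage_add_right] at hunion
    rw [← hunion]
    have hsub : ((fun x => x + -b) ⁻¹' K) ∪ ((fun x => x + -a) ⁻¹' L) ⊆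
        (fun x => (1 / 2 : ℝ) * x) ⁻¹' D := by
      rintro z (hz | hz)
      · have := h _ (hKA hz) b (hLB hbL)
        simp only [mem_preimage]
        convert this using 1; ring
      · have := h a (hKA haK) _ (hLB hz)
        simp only [mem_preimage]
        convert this using 1; ring
    refine (measure_mono hsub).trans ?_
    rw [Real.volume_preimage_mul_left (by norm_num)]
    norm_num
  have exhaust : ∀ {S : Set ℝ}, MeasurableSet S → S.Nonempty → ∀ {c e : ℝ≥0∞},
      (∀ K ⊆ S, IsCompact K → K.Nonempty → volume K + c ≤ e) → volume S + c ≤ e := by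
    intro S hS hS0 c e hK
    rw [hS.measure_eq_iSup_isCompact, ENNReal.iSup_add]
    refine iSup_le fun K => ?_
    by_cases hKS : K ⊆ S ∧ IsCompact K
    · simp only [hKS.1, hKS.2, iSup_pos]
      rcases K.eq_empty_or_nonempty with rfl | hK0
      · obtain ⟨x, hx⟩ := hS0
        simpa using hK {x} (by simpa using hx) isCompact_singleton (singleton_nonempty x)
      · exact hK K hKS.1 hKS.2 hK0
    · obtain ⟨x, hx⟩ := hS0
      have := hK {x} (by simpa using hx) isCompact_singleton (singleton_nonempty x)
      have h0 : (⨆ (_ : K ⊆ S), ⨆ (_ : IsCompact K), volume K) = 0 := by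
        simp only [ENNReal.iSup_eq_zero]
        intro h1 h2
        exact absurd ⟨h1, h2⟩ hKS
      rw [h0]
      simpa using this
  refine exhaust hA hA0 fun K hKA hK hK0 => ?_
  rw [add_comm]
  refine exhaust hB hB0 fun L hLB hL hL0 => ?_
  rw [add_comm]
  exact compact_case K hKA hK hK0 L hLB hL hL0

/-- A normalised arithmetic form of the Prékopa–Leindler inequality on the line. -/
lemma lintegral_add_le_of_normalized {f g h : ℝ → ℝ}
    (hf : Measurable f) (hg : Measurable g) (hh : Measurable h)
    (hf0 : ∀ x, 0 ≤ f x) (hg0 : ∀ x, 0 ≤ g x) (hh0 : ∀ x, 0 ≤ h x)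
    (hf1 : ∀ x, f x ≤ 1) (hg1 : ∀ x, g x ≤ 1)
    (hfs : ∀ t < 1, ∃ x, t < f x) (hgs : ∀ t < 1, ∃ x, t < g x)
    (hfgh : ∀ x y t, 0 < t → t < 1 → t < f x → t < g y → t < h ((x + y) / 2)) :
    (∫⁻ x, ENNReal.ofReal (f x)) + ∫⁻ x, ENNReal.ofReal (g x) ≤
      2 * ∫⁻ x, ENNReal.ofReal (h x) := by
  rw [lintegral_eq_lintegral_meas_lt _ (Eventually.of_forall hf0) hf.aemeasurable,
    lintegral_eq_lintegral_meas_lt _ (Eventually.of_forall hg0) hg.aemeasurable,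
    lintegral_eq_lintegral_meas_lt _ (Eventually.of_forall hh0) hh.aemeasurable]
  have anti : ∀ u : ℝ → ℝ, Measurable fun t => volume {a | t < u a} := fun u =>
    Antitone.measurable fun s t hst => measure_mono fun a (ha : t < u a) => lt_of_le_of_lt hst ha
  rw [← lintegral_add_left (anti f), ← lintegral_const_mul _ (anti h)]
  refine setLIntegral_mono ((anti h).const_mul _) fun t ht => ?_
  rcases lt_or_ge t 1 with ht1 | ht1
  · exact volume_add_le_of_midpoint_mem (measurableSet_lt measurable_const hf)
      (measurableSet_lt measurable_const hg) (hfs t ht1) (hgs t ht1)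
      fun x hx y hy => hfgh x y t ht ht1 hx hy
  · have h1 : {a | t < f a} = ∅ := by
      ext a; simpa using (hf1 a).trans ht1
    have h2 : {a | t < g a} = ∅ := by
      ext a; simpa using (hg1 a).trans ht1
    simp [h1, h2]

/-- The midpoint Prékopa–Leindler inequality with respect to a measure. -/
def MidpointPrekopa {E : Type*} [MeasurableSpace E] [AddCommGroup E] [Module ℝ E]
    (ν : Measure E) : Prop :=
  ∀ f g h : E → ℝ≥0∞, Measurable f → Measurable g → Measurable h →
    (∀ x y, f x * g y ≤ h ((1 / 2 : ℝ) • (x + y)) ^ 2) →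
    (∫⁻ x, f x ∂ν) * (∫⁻ x, g x ∂ν) ≤ (∫⁻ x, h x ∂ν) ^ 2

/-- The midpoint Prékopa–Leindler inequality on the line for bounded functions. -/
lemma lintegral_mul_le_of_bounded {f g h : ℝ → ℝ≥0∞} (hf : Measurable f) (hg : Measurable g)
    (hh : Measurable h) (hfb : ⨆ x, f x ≠ ∞) (hgb : ⨆ x, g x ≠ ∞)
    (hfgh : ∀ x y, f x * g y ≤ h ((x + y) / 2) ^ 2) :
    (∫⁻ x, f x) * (∫⁻ x, g x) ≤ (∫⁻ x, h x) ^ 2 := by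
  rcases eq_or_ne (⨆ x, f x) 0 with hM | hM
  · have : ∀ x, f x = 0 := by simpa using hM
    simp [this]
  rcases eq_or_ne (⨆ x, g x) 0 with hN | hN
  · have : ∀ x, g x = 0 := by simpa using hN
    simp [this]
  have hfM : ∀ x, f x ≤ ⨆ x, f x := le_iSup f
  have hgN : ∀ x, g x ≤ ⨆ x, g x := le_iSup g
  have hfsup : ∀ a < ⨆ x, f x, ∃ x, a < f x := fun a ha => lt_iSup_iff.1 ha
  have hgsup : ∀ a < ⨆ x, g x, ∃ x, a < g x := fun a ha => lt_iSup_iff.1 ha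
  obtain ⟨m, hm, hMm⟩ : ∃ m : ℝ, 0 < m ∧ ⨆ x, f x = ENNReal.ofReal m :=
    ⟨_, ENNReal.toReal_pos hM hfb, (ENNReal.ofReal_toReal hfb).symm⟩
  obtain ⟨k, hk, hNk⟩ : ∃ k : ℝ, 0 < k ∧ ⨆ x, g x = ENNReal.ofReal k :=
    ⟨_, ENNReal.toReal_pos hN hgb, (ENNReal.ofReal_toReal hgb).symm⟩
  rw [hMm] at hfM hfsup
  rw [hNk] at hgN hgsup
  have hff : ∀ x, f x ≠ ∞ := fun x => ne_top_of_le_ne_top ENNReal.ofReal_ne_top (hfM x)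
  have hgf : ∀ x, g x ≠ ∞ := fun x => ne_top_of_le_ne_top ENNReal.ofReal_ne_top (hgN x)
  set c := √(m * k) with hc
  have hc0 : 0 < c := Real.sqrt_pos.2 (mul_pos hm hk)
  have hc2 : c ^ 2 = m * k := Real.sq_sqrt (mul_pos hm hk).le
  have hhf : ∀ x, min (h x) (ENNReal.ofReal c) ≠ ∞ := fun x =>
    ne_top_of_le_ne_top ENNReal.ofReal_ne_top (min_le_right _ _)
  have approx : ∀ (u : ℝ → ℝ≥0∞) (s : ℝ), 0 < s → (∀ x, u x ≠ ∞) →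
      (∀ a < ENNReal.ofReal s, ∃ x, a < u x) → ∀ t < 1, ∃ x, t < (u x).toReal / s := by
    intro u s hs hu hsup t ht
    obtain ⟨x, hx⟩ := hsup (ENNReal.ofReal (t * s))
      ((ENNReal.ofReal_lt_ofReal_iff hs).2 (by nlinarith))
    refine ⟨x, ?_⟩
    rw [lt_div_iff₀ hs]
    by_contra! hle
    exact absurd hx (not_lt.2 (by
      rw [← ENNReal.ofReal_toReal (hu x)]; exact ENNReal.ofReal_le_ofReal hle))
  have key := lintegral_add_le_of_normalized (f := fun x => (f x).toReal / m)
    (g := fun x => (g x).toReal / k) (h := fun x => (min (h x) (ENNReal.ofReal c)).toReal / c)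
    (hf.ennreal_toReal.div_const _) (hg.ennreal_toReal.div_const _)
    ((hh.min measurable_const).ennreal_toReal.div_const _)
    (fun x => by positivity) (fun x => by positivity) (fun x => by positivity)
    (fun x => (div_le_one hm).2 (ENNReal.toReal_le_of_le_ofReal hm.le (hfM x)))
    (fun x => (div_le_one hk).2 (ENNReal.toReal_le_of_le_ofReal hk.le (hgN x)))
    (approx f m hm hff hfsup) (approx g k hk hgf hgsup) (by
      intro x y t ht0 ht1 hx hy
      rw [lt_div_iff₀ hm] at hx
      rw [lt_div_iff₀ hk] at hy
      rw [lt_div_iff₀ hc0]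
      rcases le_total (h ((x + y) / 2)) (ENNReal.ofReal c) with hle | hle
      · rw [min_eq_left hle]
        have hfin := ne_top_of_le_ne_top ENNReal.ofReal_ne_top hle
        have h1 := ENNReal.toReal_mono (ENNReal.pow_ne_top hfin) (hfgh x y)
        rw [ENNReal.toReal_mul, ENNReal.toReal_pow] at h1
        refine lt_of_pow_lt_pow_left₀ 2 ENNReal.toReal_nonneg (lt_of_lt_of_le ?_ h1)
        calc (t * c) ^ 2 = (t * m) * (t * k) := by rw [mul_pow, hc2]; ring
          _ < _ := by gcongr
      · rw [min_eq_right hle, ENNReal.toReal_ofReal hc0.le]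
        nlinarith)
  have scale : ∀ (u : ℝ → ℝ≥0∞) (s : ℝ), 0 < s → Measurable u → (∀ x, u x ≠ ∞) →
      ∫⁻ x, ENNReal.ofReal ((u x).toReal / s) = (∫⁻ x, u x) / ENNReal.ofReal s := by
    intro u s hs hum hu
    simp_rw [div_eq_mul_inv]
    rw [← lintegral_mul_const _ hum]
    refine lintegral_congr fun x => ?_
    rw [ENNReal.ofReal_mul ENNReal.toReal_nonneg, ENNReal.ofReal_toReal (hu x),
      ENNReal.ofReal_inv_of_pos hs]
  rw [scale f m hm hf hff, scale g k hk hg hgf, scale _ c hc0 (hh.min measurable_const) hhf] at key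
  have key2 : (∫⁻ x, f x) / ENNReal.ofReal m + (∫⁻ x, g x) / ENNReal.ofReal k ≤
      2 * ((∫⁻ x, h x) / ENNReal.ofReal c) := by
    refine key.trans ?_
    gcongr
    exact min_le_left _ _
  rcases eq_or_ne (∫⁻ x, h x) ∞ with hH | hH
  · simp [hH]
  have hR : 2 * ((∫⁻ x, h x) / ENNReal.ofReal c) ≠ ∞ :=
    ENNReal.mul_ne_top (by simp) (ENNReal.div_ne_top hH (by simpa using hc0))
  have hL := ne_top_of_le_ne_top hR key2
  have finite_of_div : ∀ (I : ℝ≥0∞) (s : ℝ), I / ENNReal.ofReal s ≠ ∞ → I ≠ ∞ := by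
    rintro I s hI rfl
    exact hI (ENNReal.top_div_of_ne_top ENNReal.ofReal_ne_top)
  have hF := finite_of_div _ _ (ENNReal.add_ne_top.1 hL).1
  have hG := finite_of_div _ _ (ENNReal.add_ne_top.1 hL).2
  have key3 := ENNReal.toReal_mono hR key2
  rw [ENNReal.toReal_add (ENNReal.add_ne_top.1 hL).1 (ENNReal.add_ne_top.1 hL).2] at key3
  simp only [ENNReal.toReal_mul, ENNReal.toReal_div, ENNReal.toReal_ofReal hm.le,
    ENNReal.toReal_ofReal hk.le, ENNReal.toReal_ofReal hc0.le, ENNReal.toReal_ofNat] at key3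
  rw [← ENNReal.toReal_le_toReal (ENNReal.mul_ne_top hF hG) (ENNReal.pow_ne_top hH),
    ENNReal.toReal_mul, ENNReal.toReal_pow]
  set F := (∫⁻ x, f x).toReal
  set G := (∫⁻ x, g x).toReal
  set H := (∫⁻ x, h x).toReal
  have hF0 : 0 ≤ F / m := by positivity
  have hG0 : 0 ≤ G / k := by positivity
  have hprod : (F / m) * (G / k) ≤ (H / c) ^ 2 := by
    nlinarith [sq_nonneg (F / m - G / k)]
  rw [div_pow, hc2, div_mul_div_comm] at hprod
  exact (div_le_div_iff_of_pos_right (mul_pos hm hk)).1 hprod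

lemma midpointPrekopa_real : MidpointPrekopa (volume : Measure ℝ) := by
  intro f g h hf hg hh hfgh
  have trunc : ∀ u : ℝ → ℝ≥0∞, Measurable u → ∫⁻ x, u x = ⨆ n : ℕ, ∫⁻ x, min (u x) n := by
    intro u hu
    rw [← lintegral_iSup (fun n => hu.min measurable_const)
      (fun i j hij x => min_le_min_left _ (by exact_mod_cast hij))]
    refine lintegral_congr fun x => ?_
    have := inf_iSup_eq (u x) (fun n : ℕ => (n : ℝ≥0∞))
    rw [ENNReal.iSup_natCast, inf_top_eq] at this
    exact this
  rw [trunc f hf, trunc g hg, ENNReal.iSup_mul]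
  refine iSup_le fun i => ?_
  rw [ENNReal.mul_iSup]
  refine iSup_le fun j => ?_
  refine lintegral_mul_le_of_bounded (hf.min measurable_const) (hg.min measurable_const) hh
    (ne_top_of_le_ne_top (ENNReal.natCast_ne_top i) (iSup_le fun x => min_le_right _ _))
    (ne_top_of_le_ne_top (ENNReal.natCast_ne_top j) (iSup_le fun x => min_le_right _ _))
    fun x y => ?_
  refine (mul_le_mul' (min_le_left _ _) (min_le_left _ _)).trans ((hfgh x y).trans_eq ?_)
  congr 2
  simp only [smul_eq_mul]
  ring

lemma MidpointPrekopa.prod {E F : Type*} [MeasurableSpace E] [AddCommGroup E] [Module ℝ E]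
    [MeasurableSpace F] [AddCommGroup F] [Module ℝ F] {ν : Measure E} {ρ : Measure F}
    [SFinite ν] [SFinite ρ] (hν : MidpointPrekopa ν) (hρ : MidpointPrekopa ρ) :
    MidpointPrekopa (ν.prod ρ) := by
  intro f g h hf hg hh hfgh
  rw [lintegral_prod _ hf.aemeasurable, lintegral_prod _ hg.aemeasurable,
    lintegral_prod _ hh.aemeasurable]
  refine hν _ _ _ hf.lintegral_prod_right' hg.lintegral_prod_right' hh.lintegral_prod_right'
    fun x x' => ?_
  refine hρ _ _ _ (hf.comp measurable_prodMk_left) (hg.comp measurable_prodMk_left)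
    (hh.comp measurable_prodMk_left) fun y y' => ?_
  simpa using hfgh (x, y) (x', y')

lemma MidpointPrekopa.of_measurePreserving {E F : Type*} [MeasurableSpace E] [AddCommGroup E]
    [Module ℝ E] [MeasurableSpace F] [AddCommGroup F] [Module ℝ F] {ν : Measure E} {ρ : Measure F}
    (hν : MidpointPrekopa ν) (e : E →ₗ[ℝ] F) (he : MeasurePreserving e ν ρ) :
    MidpointPrekopa ρ := by
  intro f g h hf hg hh hfgh
  rw [← he.lintegral_comp hf, ← he.lintegral_comp hg, ← he.lintegral_comp hh]
  refine hν _ _ _ (hf.comp he.measurable) (hg.comp he.measurable) (hh.comp he.measurable)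
    fun x y => ?_
  simpa using hfgh (e x) (e y)

lemma midpointPrekopa_pi (n : ℕ) : MidpointPrekopa (volume : Measure (Fin n → ℝ)) := by
  induction n with
  | zero =>
    intro f g h hf hg hh hfgh
    rw [Measure.volume_pi_eq_dirac 0, lintegral_dirac, lintegral_dirac, lintegral_dirac]
    simpa using hfgh 0 0
  | succ n ih =>
    have := midpointPrekopa_real.prod ih
    refine this.of_measurePreserving
      (Fin.consLinearEquiv ℝ (fun _ : Fin (n + 1) => ℝ)).toLinearMap ?_
    have hp := (volume_preserving_piFinSuccAbove (fun _ : Fin (n + 1) => ℝ) 0).symm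
    have heq : ((Fin.consLinearEquiv ℝ (fun _ : Fin (n + 1) => ℝ)).toLinearMap : _ → _) =
        (MeasurableEquiv.piFinSuccAbove (fun _ : Fin (n + 1) => ℝ) 0).symm := by
      funext p
      simp [MeasurableEquiv.piFinSuccAbove, Fin.insertNthEquiv]
      rfl
    rw [heq]
    exact hp

lemma midpointPrekopa_eucSp (n : ℕ) : MidpointPrekopa (volume : Measure (EucSp n)) :=
  (midpointPrekopa_pi n).of_measurePreserving
    (WithLp.linearEquiv 2 ℝ (Fin n → ℝ)).symm.toLinearMap (PiLp.volume_preserving_toLp (Fin n))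

/-- A log-concave function agrees almost everywhere with a Borel measurable nonnegative function
that is midpoint log-concave. -/
lemma IsLogConcaveFn.exists_measurable_ae_eq {n : ℕ} {f : EucSp n → ℝ} (hf : IsLogConcaveFn f) :
    ∃ g : EucSp n → ℝ, Measurable g ∧ (∀ x, 0 ≤ g x) ∧ f =ᵐ[volume] g ∧
      ∀ x y, g x * g y ≤ g ((1 / 2 : ℝ) • (x + y)) ^ 2 := by
  obtain ⟨hf0, hfc⟩ := hf
  set S : Set (EucSp n) := {x | 0 < f x}
  have pos : ∀ x ∈ S, ∀ y ∈ S, ∀ l ∈ Icc (0 : ℝ) 1, 0 < f ((1 - l) • x + l • y) :=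
    fun x hx y hy l hl => lt_of_lt_of_le
      (mul_pos (Real.rpow_pos_of_pos hx _) (Real.rpow_pos_of_pos hy _)) (hfc x y l hl)
  have hS : Convex ℝ S := by
    intro x hx y hy a b ha hb hab
    obtain rfl : a = 1 - b := by linarith
    exact pos x hx y hy b ⟨hb, by linarith⟩
  set U := interior S
  have hU : Convex ℝ U := hS.interior
  have hUS : U ⊆ S := interior_subset
  have hlog : ConcaveOn ℝ U (fun x => Real.log (f x)) := by
    refine ⟨hU, fun x hx y hy a b ha hb hab => ?_⟩
    obtain rfl : a = 1 - b := by linarith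
    have hx0 : 0 < f x := hUS hx
    have hy0 : 0 < f y := hUS hy
    have h1 := Real.log_le_log
      (mul_pos (Real.rpow_pos_of_pos hx0 (1 - b)) (Real.rpow_pos_of_pos hy0 b))
      (hfc x y b ⟨hb, by linarith⟩)
    rw [Real.log_mul (Real.rpow_pos_of_pos hx0 _).ne' (Real.rpow_pos_of_pos hy0 _).ne',
      Real.log_rpow hx0, Real.log_rpow hy0] at h1
    simpa using h1
  have hcont : ContinuousOn f U := by
    refine (Real.continuous_exp.comp_continuousOn (hlog.continuousOn isOpen_interior)).congr
      fun x hx => ?_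
    exact (Real.exp_log (hUS hx)).symm
  classical
  refine ⟨U.piecewise f (fun _ => 0),
    hcont.measurable_piecewise continuousOn_const isOpen_interior.measurableSet, ?_, ?_, ?_⟩
  · intro x
    by_cases hx : x ∈ U <;> simp [hx, hf0]
  · have hnull : ∀ᵐ x ∂(volume : Measure (EucSp n)), x ∉ frontier S :=
      measure_eq_zero_iff_ae_notMem.1 (hS.addHaar_frontier volume)
    filter_upwards [hnull] with x hx
    by_cases hxU : x ∈ U
    · simp [hxU]
    · have hxS : x ∉ S := fun h => hx ⟨subset_closure h, hxU⟩
      simp only [hxU, not_false_eq_true, piecewise_eq_of_notMem]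
      exact le_antisymm (not_lt.1 hxS) (hf0 x)
  · intro x y
    by_cases hx : x ∈ U
    · by_cases hy : y ∈ U
      · have hxy : (1 / 2 : ℝ) • (x + y) ∈ U := by
          rw [smul_add]
          exact hU hx hy (by norm_num) (by norm_num) (by norm_num)
        simp only [hx, hy, hxy, piecewise_eq_of_mem]
        have h1 := hfc x y (1 / 2) (by norm_num)
        have h2 : (1 - 1 / 2 : ℝ) = 1 / 2 := by norm_num
        rw [h2, ← smul_add, ← Real.sqrt_eq_rpow, ← Real.sqrt_eq_rpow] at h1
        calc f x * f y = (√(f x) * √(f y)) ^ 2 := by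
              rw [mul_pow, Real.sq_sqrt (hf0 x), Real.sq_sqrt (hf0 y)]
          _ ≤ _ := by gcongr
      · simp [hy, sq_nonneg]
    · simp [hx, sq_nonneg]

/-- Midpoint Brunn–Minkowski inequality for log-concave measures. -/
lemma IsLogConcave.measure_mul_le_sq {n : ℕ} {μ : Measure (EucSp n)} (hμ : IsLogConcave μ)
    {A B D : Set (EucSp n)} (hA : MeasurableSet A) (hB : MeasurableSet B) (hD : MeasurableSet D)
    (hABD : ∀ x ∈ A, ∀ y ∈ B, (1 / 2 : ℝ) • (x + y) ∈ D) :
    μ A * μ B ≤ μ D ^ 2 := by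
  obtain ⟨f, hf, rfl⟩ := hμ
  obtain ⟨g, hgm, hg0, hfg, hg⟩ := hf.exists_measurable_ae_eq
  have hcongr : (fun x => ENNReal.ofReal (f x)) =ᵐ[volume] fun x => ENNReal.ofReal (g x) :=
    hfg.mono fun x hx => by simp only [hx]
  rw [withDensity_congr_ae hcongr, withDensity_apply _ hA, withDensity_apply _ hB,
    withDensity_apply _ hD, ← lintegral_indicator hA, ← lintegral_indicator hB,
    ← lintegral_indicator hD]
  have hm := hgm.ennreal_ofReal
  refine midpointPrekopa_eucSp n _ _ _ (hm.indicator hA) (hm.indicator hB) (hm.indicator hD)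
    fun x y => ?_
  by_cases hx : x ∈ A
  · by_cases hy : y ∈ B
    · rw [indicator_of_mem hx, indicator_of_mem hy, indicator_of_mem (hABD x hx y hy),
        ← ENNReal.ofReal_mul (hg0 x), ← ENNReal.ofReal_pow (hg0 _)]
      exact ENNReal.ofReal_le_ofReal (hg x y)
    · simp [hy]
  · simp [hx]

/-- Borell's lemma for centered balls. -/
lemma IsLogConcave.measure_norm_gt_mul_le_sq {n : ℕ} {μ : Measure (EucSp n)}
    (hμ : IsLogConcave μ) (r : ℝ) :
    μ {x | ‖x‖ ≤ r} * μ {x | 3 * r < ‖x‖} ≤ μ {x | r < ‖x‖} ^ 2 := by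
  refine hμ.measure_mul_le_sq (measurableSet_le measurable_norm measurable_const)
    (measurableSet_lt measurable_const measurable_norm)
    (measurableSet_lt measurable_const measurable_norm) fun x hx y hy => ?_
  simp only [mem_ofPred_eq] at hx hy ⊢
  have h1 : ‖y‖ ≤ ‖x + y‖ + ‖x‖ := by
    have := norm_sub_le (x + y) x
    simpa using this
  rw [norm_smul]
  norm_num
  linarith

/-- Tails of a log-concave measure outside dilates of a ball of almost full measure decay
geometrically. -/
lemma IsLogConcave.measure_norm_gt_pow_le {n : ℕ} {μ : Measure (EucSp n)}
    [IsProbabilityMeasure μ] (hμ : IsLogConcave μ) {r : ℝ} (hr : 0 ≤ r)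
    (hp : μ.real {x | r < ‖x‖} ≤ 1 / 324) (k : ℕ) :
    μ.real {x | 3 ^ k * r < ‖x‖} ≤ μ.real {x | r < ‖x‖} * (1 / 162) ^ k := by
  induction k with
  | zero => simp
  | succ k ih =>
    have h1 : μ.real {x | ‖x‖ ≤ 3 ^ k * r} * μ.real {x | 3 * (3 ^ k * r) < ‖x‖} ≤
        μ.real {x | 3 ^ k * r < ‖x‖} ^ 2 := by
      have := ENNReal.toReal_mono (by finiteness) (hμ.measure_norm_gt_mul_le_sq (3 ^ k * r))
      rwa [ENNReal.toReal_mul, ENNReal.toReal_pow] at this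
    have h2 : μ.real {x | ‖x‖ ≤ 3 ^ k * r} = 1 - μ.real {x | 3 ^ k * r < ‖x‖} := by
      rw [← probReal_compl_eq_one_sub (measurableSet_lt measurable_const measurable_norm)]
      congr 1
      ext x
      simp
    have h3 : μ.real {x | 3 ^ k * r < ‖x‖} ≤ μ.real {x | r < ‖x‖} := by
      refine measureReal_mono (Set.ofPred_subset_ofPred.2 fun x hx => lt_of_le_of_lt ?_ hx)
      exact le_mul_of_one_le_left hr (one_le_pow₀ (by norm_num))
    rw [h2, ← mul_assoc, ← pow_succ'] at h1
    have hp0 : 0 ≤ μ.real {x | r < ‖x‖} := measureReal_nonneg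
    have hk0 : 0 ≤ μ.real {x | 3 ^ k * r < ‖x‖} := measureReal_nonneg
    have hq0 : 0 ≤ μ.real {x | 3 ^ (k + 1) * r < ‖x‖} := measureReal_nonneg
    rw [pow_succ (1 / 162 : ℝ)]
    nlinarith

/-- The fourth moment outside a ball of almost full measure is controlled by the measure of the
complement of that ball. -/
lemma IsLogConcave.lintegral_norm_pow_four_le {n : ℕ} {μ : Measure (EucSp n)}
    [IsProbabilityMeasure μ] (hμ : IsLogConcave μ) {r : ℝ} (hr : 0 < r)
    (hp : μ.real {x | r < ‖x‖} ≤ 1 / 324) :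
    ∫⁻ x in {x | r < ‖x‖}, ENNReal.ofReal (‖x‖ ^ 4) ∂μ ≤
      ENNReal.ofReal (162 * r ^ 4 * μ.real {x | r < ‖x‖}) := by
  set p := μ.real {x | r < ‖x‖}
  have hp0 : 0 ≤ p := measureReal_nonneg
  have cover : {x : EucSp n | r < ‖x‖} ⊆
      ⋃ k : ℕ, {x | 3 ^ k * r < ‖x‖ ∧ ‖x‖ ≤ 3 ^ (k + 1) * r} := by
    intro x (hx : r < ‖x‖)
    have hex : ∃ k : ℕ, ‖x‖ ≤ 3 ^ k * r := by
      obtain ⟨k, hk⟩ := pow_unbounded_of_one_lt (‖x‖ / r) (by norm_num : (1 : ℝ) < 3)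
      exact ⟨k, ((div_lt_iff₀ hr).1 hk).le⟩
    classical
    obtain ⟨k, hk⟩ : ∃ k, Nat.find hex = k + 1 := by
      refine Nat.exists_eq_succ_of_ne_zero fun h0 => ?_
      have := Nat.find_spec hex
      rw [h0] at this
      linarith
    refine mem_iUnion.2 ⟨k, ?_, ?_⟩
    · exact not_le.1 (Nat.find_min hex (by omega))
    · simpa only [hk] using Nat.find_spec hex
  refine (lintegral_mono_set cover).trans ((lintegral_iUnion_le _ _).trans ?_)
  have shell : ∀ k : ℕ, ∫⁻ x in {x | 3 ^ k * r < ‖x‖ ∧ ‖x‖ ≤ 3 ^ (k + 1) * r},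
      ENNReal.ofReal (‖x‖ ^ 4) ∂μ ≤ ENNReal.ofReal (81 * r ^ 4 * p * (1 / 2) ^ k) := by
    intro k
    have hm : MeasurableSet {x : EucSp n | 3 ^ k * r < ‖x‖ ∧ ‖x‖ ≤ 3 ^ (k + 1) * r} :=
      (measurableSet_lt measurable_const measurable_norm).inter
        (measurableSet_le measurable_norm measurable_const)
    calc _ ≤ ∫⁻ x in {x | 3 ^ k * r < ‖x‖ ∧ ‖x‖ ≤ 3 ^ (k + 1) * r},
          ENNReal.ofReal ((3 ^ (k + 1) * r) ^ 4) ∂μ := by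
          refine setLIntegral_mono measurable_const fun x hx => ?_
          have := hx.2
          gcongr
      _ = ENNReal.ofReal ((3 ^ (k + 1) * r) ^ 4) *
          μ {x | 3 ^ k * r < ‖x‖ ∧ ‖x‖ ≤ 3 ^ (k + 1) * r} := setLIntegral_const _ _
      _ ≤ ENNReal.ofReal ((3 ^ (k + 1) * r) ^ 4) * μ {x | 3 ^ k * r < ‖x‖} := by
          gcongr
          exact fun hx => hx.1
      _ = ENNReal.ofReal ((3 ^ (k + 1) * r) ^ 4 * μ.real {x | 3 ^ k * r < ‖x‖}) := by
          rw [ENNReal.ofReal_mul (by positivity), ofReal_measureReal]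
      _ ≤ _ := by
          refine ENNReal.ofReal_le_ofReal ?_
          calc _ ≤ (3 ^ (k + 1) * r) ^ 4 * (p * (1 / 162) ^ k) := by
                gcongr
                exact hμ.measure_norm_gt_pow_le hr.le hp k
            _ = 81 * r ^ 4 * p * (3 ^ 4 * (1 / 162)) ^ k := by
                rw [mul_pow (3 ^ 4 : ℝ), ← pow_mul 3 4 k, mul_comm 4 k]
                ring
            _ = _ := by norm_num
  refine (ENNReal.tsum_le_tsum shell).trans ?_
  rw [← ENNReal.ofReal_tsum_of_nonneg (fun k => by positivity)
    ((summable_geometric_two).mul_left _), tsum_mul_left, tsum_geometric_two]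
  exact ENNReal.ofReal_le_ofReal (by linarith)

lemma IsIsotropic.integrable_apply_sq {n : ℕ} {μ : Measure (EucSp n)} (hμ : IsIsotropic μ)
    (i : Fin n) : Integrable (fun x : EucSp n => x i ^ 2) μ ∧ ∫ x, x i ^ 2 ∂μ = 1 := by
  have h := hμ.2 (EuclideanSpace.single i 1) (EuclideanSpace.single i 1)
  have h1 : ∫ x, x i ^ 2 ∂μ = 1 := by
    simpa [← sq, EuclideanSpace.inner_single_right] using h
  exact ⟨.of_integral_ne_zero (by rw [h1]; exact one_ne_zero), h1⟩

lemma IsIsotropic.integrable_norm_sq {n : ℕ} {μ : Measure (EucSp n)} (hμ : IsIsotropic μ) :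
    Integrable (fun x => ‖x‖ ^ 2) μ := by
  simp_rw [EuclideanSpace.real_norm_sq_eq]
  exact integrable_finsetSum _ fun i _ => (hμ.integrable_apply_sq i).1

lemma IsIsotropic.integral_norm_sq {n : ℕ} {μ : Measure (EucSp n)} (hμ : IsIsotropic μ) :
    ∫ x, ‖x‖ ^ 2 ∂μ = n := by
  simp_rw [EuclideanSpace.real_norm_sq_eq]
  rw [integral_finsetSum _ fun i _ => (hμ.integrable_apply_sq i).1]
  simp [(hμ.integrable_apply_sq _).2]

lemma norm_sub_sqrt_sq_le {n : ℕ} (x : EucSp n) : (‖x‖ - √n) ^ 2 ≤ ‖x‖ ^ 2 + n := by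
  have h1 : √(n : ℝ) ^ 2 = n := Real.sq_sqrt (by positivity)
  nlinarith [mul_nonneg (norm_nonneg x) (Real.sqrt_nonneg n)]

lemma IsIsotropic.integrable_norm_sub_sqrt_sq {n : ℕ} {μ : Measure (EucSp n)}
    [IsProbabilityMeasure μ] (hμ : IsIsotropic μ) :
    Integrable (fun x => (‖x‖ - √n) ^ 2) μ := by
  refine (hμ.integrable_norm_sq.add (integrable_const (n : ℝ))).mono'
    (by fun_prop) (Eventually.of_forall fun x => ?_)
  rw [Real.norm_of_nonneg (sq_nonneg _)]
  exact norm_sub_sqrt_sq_le x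

lemma IsIsotropic.integral_norm_sub_sqrt_sq_le {n : ℕ} {μ : Measure (EucSp n)}
    [IsProbabilityMeasure μ] (hμ : IsIsotropic μ) :
    ∫ x, (‖x‖ - √n) ^ 2 ∂μ ≤ 2 * n := by
  refine (integral_mono hμ.integrable_norm_sub_sqrt_sq
    (hμ.integrable_norm_sq.add (integrable_const (n : ℝ))) norm_sub_sqrt_sq_le).trans_eq ?_
  simp only [Pi.add_apply]
  rw [integral_add hμ.integrable_norm_sq (integrable_const _), hμ.integral_norm_sq]
  simp
  ring

/-- For isotropic log-concave measures, the variance of `‖x‖ ^ 2` is controlled by `n` times the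
mean square deviation of `‖x‖` from `√n`. -/
lemma IsLogConcave.integral_norm_sq_sub_sq_le {n : ℕ} (hn : 1 ≤ n) {μ : Measure (EucSp n)}
    [IsProbabilityMeasure μ] (hiso : IsIsotropic μ) (hμ : IsLogConcave μ) :
    ∫ x, (‖x‖ ^ 2 - (n : ℝ)) ^ 2 ∂μ ≤ (361 + 162 * 18 ^ 4) * n * ∫ x, (‖x‖ - √n) ^ 2 ∂μ := by
  have hn0 : (0 : ℝ) < n := by exact_mod_cast hn
  set s := √(n : ℝ)
  have hs0 : 0 < s := Real.sqrt_pos.2 hn0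
  have hs2 : s ^ 2 = n := Real.sq_sqrt hn0.le
  set V := ∫ x, (‖x‖ - s) ^ 2 ∂μ
  have hV0 : 0 ≤ V := integral_nonneg fun x => sq_nonneg _
  set r := 18 * s with hr
  have hr0 : 0 < r := by positivity
  set p := μ.real {x | r < ‖x‖}
  have hm : MeasurableSet {x : EucSp n | r < ‖x‖} :=
    measurableSet_lt measurable_const measurable_norm
  have hp : p ≤ 1 / 324 := by
    have h1 := mul_meas_ge_le_integral_of_nonneg
      (Eventually.of_forall fun x : EucSp n => sq_nonneg ‖x‖) hiso.integrable_norm_sq (r ^ 2)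
    have h2 : p ≤ μ.real {x | r ^ 2 ≤ ‖x‖ ^ 2} :=
      measureReal_mono (Set.ofPred_subset_ofPred.2 fun x hx => by gcongr)
    rw [hiso.integral_norm_sq] at h1
    have h3 : r ^ 2 = 324 * n := by rw [hr, mul_pow, hs2]; norm_num
    have h4 : r ^ 2 * p ≤ n := le_trans (by gcongr) h1
    rw [h3] at h4
    nlinarith
  have hpV : n * p ≤ V := by
    have h1 := mul_meas_ge_le_integral_of_nonneg
      (Eventually.of_forall fun x : EucSp n => sq_nonneg (‖x‖ - s))
      hiso.integrable_norm_sub_sqrt_sq (s ^ 2)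
    have h2 : p ≤ μ.real {x | s ^ 2 ≤ (‖x‖ - s) ^ 2} := by
      refine measureReal_mono (Set.ofPred_subset_ofPred.2 fun x hx => ?_)
      gcongr
      linarith
    rw [← hs2]
    exact le_trans (by gcongr) h1
  have inner_part : ∫⁻ x in {x | r < ‖x‖}ᶜ, ENNReal.ofReal ((‖x‖ ^ 2 - (n : ℝ)) ^ 2) ∂μ ≤
      ENNReal.ofReal (361 * n * V) := by
    calc _ ≤ ∫⁻ x in {x | r < ‖x‖}ᶜ, ENNReal.ofReal (361 * n * (‖x‖ - s) ^ 2) ∂μ := by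
          refine setLIntegral_mono (by fun_prop) fun x hx => ENNReal.ofReal_le_ofReal ?_
          have hx : ‖x‖ ≤ r := not_lt.1 hx
          have hb : (‖x‖ + s) ^ 2 ≤ (19 * s) ^ 2 := by
            gcongr
            linarith
          calc (‖x‖ ^ 2 - (n : ℝ)) ^ 2 = (‖x‖ + s) ^ 2 * (‖x‖ - s) ^ 2 := by rw [← hs2]; ring
            _ ≤ (19 * s) ^ 2 * (‖x‖ - s) ^ 2 := by gcongr
            _ = _ := by rw [← hs2]; ring
      _ ≤ ∫⁻ x, ENNReal.ofReal (361 * n * (‖x‖ - s) ^ 2) ∂μ := setLIntegral_le_lintegral _ _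
      _ = ENNReal.ofReal (361 * n * V) := by
          rw [← ofReal_integral_eq_lintegral_ofReal
            (hiso.integrable_norm_sub_sqrt_sq.const_mul _)
            (Eventually.of_forall fun x => by positivity), integral_const_mul]
  have outer_part : ∫⁻ x in {x | r < ‖x‖}, ENNReal.ofReal ((‖x‖ ^ 2 - (n : ℝ)) ^ 2) ∂μ ≤
      ENNReal.ofReal (162 * 18 ^ 4 * n * V) := by
    calc _ ≤ ∫⁻ x in {x | r < ‖x‖}, ENNReal.ofReal (‖x‖ ^ 4) ∂μ := by
          refine setLIntegral_mono (by fun_prop) fun x hx => ENNReal.ofReal_le_ofReal ?_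
          have hx : r < ‖x‖ := hx
          have h1 : (n : ℝ) ≤ ‖x‖ ^ 2 := by
            rw [← hs2]
            gcongr
            linarith
          calc (‖x‖ ^ 2 - (n : ℝ)) ^ 2 ≤ (‖x‖ ^ 2) ^ 2 := by
                gcongr
                linarith
            _ = _ := by ring
      _ ≤ ENNReal.ofReal (162 * r ^ 4 * p) := hμ.lintegral_norm_pow_four_le hr0 hp
      _ ≤ _ := by
          refine ENNReal.ofReal_le_ofReal ?_
          calc 162 * r ^ 4 * p = 162 * 18 ^ 4 * n * (n * p) := by
                rw [hr, ← hs2]; ring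
            _ ≤ _ := by gcongr
  rw [integral_eq_lintegral_of_nonneg_ae (Eventually.of_forall fun x => sq_nonneg _)
    (by fun_prop)]
  refine ENNReal.toReal_le_of_le_ofReal (by positivity) ?_
  rw [← lintegral_add_compl _ hm]
  refine (add_le_add outer_part inner_part).trans_eq ?_
  rw [← ENNReal.ofReal_add (by positivity) (by positivity)]
  congr 1
  ring

/-- There exists a universal constant C > 0 such that for any n ≥ 1,
(1/n) sup_X E(|X|² − n)² ≤ C σ_n², the supremum running over all isotropic,
log-concave random vectors X in ℝⁿ. -/
theorem inv_n_sup_second_moment_le_sigmaN_sq :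
    ∃ C : ℝ, 0 < C ∧ ∀ n : ℕ, 1 ≤ n →
      (1 / (n : ℝ)) *
        sSup {v | ∃ μ : Measure (EucSp n), IsProbabilityMeasure μ ∧ IsIsotropic μ ∧
          IsLogConcave μ ∧ v = ∫ x, (‖x‖ ^ 2 - (n : ℝ)) ^ 2 ∂μ}
      ≤ C * sigmaN n ^ 2 := by
  refine ⟨361 + 162 * 18 ^ 4, by norm_num, fun n hn => ?_⟩
  have hn0 : (0 : ℝ) < n := by exact_mod_cast hn
  have hbdd : BddAbove {v | ∃ μ : Measure (EucSp n), IsProbabilityMeasure μ ∧ IsIsotropic μ ∧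
      IsLogConcave μ ∧ v = ∫ x, (‖x‖ - Real.sqrt n) ^ 2 ∂μ} := by
    refine ⟨2 * n, ?_⟩
    rintro v ⟨μ, hμ, hiso, -, rfl⟩
    exact hiso.integral_norm_sub_sqrt_sq_le
  have hσ0 : 0 ≤ sigmaNSq n := by
    refine Real.sSup_nonneg ?_
    rintro v ⟨μ, -, -, -, rfl⟩
    exact integral_nonneg fun x => sq_nonneg _
  rw [sigmaN, Real.sq_sqrt hσ0, one_div, inv_mul_le_iff₀ hn0]
  refine Real.sSup_le ?_ (by positivity)
  rintro v ⟨μ, hμ, hiso, hlc, rfl⟩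
  calc _ ≤ (361 + 162 * 18 ^ 4) * n * ∫ x, (‖x‖ - √n) ^ 2 ∂μ :=
        hlc.integral_norm_sq_sub_sq_le hn hiso
    _ ≤ (361 + 162 * 18 ^ 4) * n * sigmaNSq n := by
        gcongr
        exact le_csSup hbdd ⟨μ, hμ, hiso, hlc, rfl⟩
    _ = _ := by ring
end
end

section
/- Let μ be a compactly-supported Borel probability measure on ℝⁿ whose support is not contained in a hyperplane, and let K ⊂ ℝⁿ be the interior of the convex hull of the support of μ. Then ∫_{ℝⁿ} det ∇²Λ_μ(ξ) dξ = Vol_n(K), where Vol_n is the Lebesgue measure on ℝⁿ. -/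
open MeasureTheory Real Set Filter Topology RealInnerProductSpace
noncomputable section

/-- The support of a Borel measure: the minimal closed set of full measure,
i.e. the set of points all of whose neighborhoods have positive measure. -/
def msupport {n : ℕ} (μ : Measure (EucSp n)) : Set (EucSp n) :=
  {x | ∀ U ∈ nhds x, μ U ≠ 0}

/-- μ is compactly supported. -/
def IsCompactlySupported {n : ℕ} (μ : Measure (EucSp n)) : Prop :=
  ∃ K : Set (EucSp n), IsCompact K ∧ μ Kᶜ = 0

/-- The support of μ is not contained in a hyperplane (an affine hyperplane). -/
def SuppNotInHyperplane {n : ℕ} (μ : Measure (EucSp n)) : Prop :=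
  ¬ ∃ (θ : EucSp n) (c : ℝ), θ ≠ 0 ∧ msupport μ ⊆ {x | ⟪θ, x⟫ = c}

/-- The logarithmic Laplace transform Λ_μ(ξ) = log ∫ exp(ξ·x) dμ(x). -/
def logLaplace {n : ℕ} (μ : Measure (EucSp n)) (ξ : EucSp n) : ℝ :=
  Real.log (∫ x, Real.exp ⟪ξ, x⟫ ∂μ)

/-- The Hessian matrix of a function f : ℝⁿ → ℝ at a point ξ. -/
def hessianM {n : ℕ} (f : EucSp n → ℝ) (ξ : EucSp n) : Matrix (Fin n) (Fin n) ℝ :=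
  Matrix.of fun i j =>
    fderiv ℝ (fun η => fderiv ℝ f η (EuclideanSpace.single j 1)) ξ
      (EuclideanSpace.single i 1)

/-- Ψ_μ(ξ) = log ( det ∇²Λ_μ(ξ) / det ∇²Λ_μ(0) ). -/
def PsiFn {n : ℕ} (μ : Measure (EucSp n)) (ξ : EucSp n) : ℝ :=
  Real.log ((hessianM (logLaplace μ) ξ).det / (hessianM (logLaplace μ) 0).det)

section ExponentialIntegrals

variable {n : ℕ} {μ : Measure (EucSp n)}
variable {F : Type*} [NormedAddCommGroup F]

lemma IsCompactlySupported.exists_restrict_eq (hμ : IsCompactlySupported μ) :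
    ∃ K : Set (EucSp n), IsCompact K ∧ μ.restrict K = μ := by
  obtain ⟨K, hK, h0⟩ := hμ
  exact ⟨K, hK, Measure.restrict_eq_self_of_ae_mem h0⟩

lemma IsCompactlySupported.integrable [IsFiniteMeasure μ] (hμ : IsCompactlySupported μ)
    {f : EucSp n → F} (hf : Continuous f) : Integrable f μ := by
  obtain ⟨K, hK, h⟩ := hμ.exists_restrict_eq
  have := hf.continuousOn.integrableOn_compact (μ := μ) hK
  rwa [IntegrableOn, h] at this

lemma msupport_eq_support (μ : Measure (EucSp n)) : msupport μ = μ.support := by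
  ext x
  simp [msupport, Measure.mem_support_iff_forall, pos_iff_ne_zero]

lemma ae_mem_msupport (μ : Measure (EucSp n)) : ∀ᵐ x ∂μ, x ∈ msupport μ := by
  rw [msupport_eq_support]
  exact Measure.support_mem_ae

lemma msupport_subset_of_isClosed {s : Set (EucSp n)} (hs : IsClosed s)
    (h : ∀ᵐ x ∂μ, x ∈ s) : msupport μ ⊆ s := by
  rw [msupport_eq_support]
  exact Measure.support_subset_of_isClosed hs h

variable [NormedSpace ℝ F]

/-- The integral of `h` against the exponentially weighted measure `exp ⟪ξ, x⟫ dμ(x)`. -/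
def expIntegral (μ : Measure (EucSp n)) (h : EucSp n → F) (ξ : EucSp n) : F :=
  ∫ x, Real.exp ⟪ξ, x⟫ • h x ∂μ

lemma hasFDerivAt_expIntegral [IsFiniteMeasure μ] (hμ : IsCompactlySupported μ)
    {h : EucSp n → F} (hh : Continuous h) (ξ : EucSp n) :
    HasFDerivAt (expIntegral μ h)
      (expIntegral μ (fun x => (innerSL ℝ x).smulRight (h x)) ξ) ξ := by
  have hcont : Continuous fun x : EucSp n => (innerSL ℝ x).smulRight (h x) := by fun_prop
  refine hasFDerivAt_integral_of_dominated_of_fderiv_le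
    (F' := fun η x => Real.exp ⟪η, x⟫ • (innerSL ℝ x).smulRight (h x))
    (bound := fun x => Real.exp ((‖ξ‖ + 1) * ‖x‖) * ‖(innerSL ℝ x).smulRight (h x)‖)
    (Metric.ball_mem_nhds ξ one_pos)
    (Eventually.of_forall fun η => ?_) ?_ ?_ ?_ ?_ ?_
  · exact (hμ.integrable (by fun_prop)).aestronglyMeasurable
  · exact hμ.integrable (by fun_prop)
  · exact (hμ.integrable (by fun_prop)).aestronglyMeasurable
  · refine Eventually.of_forall fun x η hη => ?_
    rw [norm_smul, Real.norm_eq_abs, Real.abs_exp]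
    gcongr
    have : ‖η‖ ≤ ‖ξ‖ + 1 := by
      have := norm_le_norm_add_norm_sub' η ξ
      have := mem_ball_iff_norm.1 hη
      linarith
    calc ⟪η, x⟫ ≤ ‖η‖ * ‖x‖ := real_inner_le_norm _ _
      _ ≤ _ := by gcongr
  · exact hμ.integrable (by fun_prop)
  · refine Eventually.of_forall fun x η _ => ?_
    have h1 : HasFDerivAt (fun η : EucSp n => ⟪η, x⟫) (innerSL ℝ x) η := by
      simp_rw [real_inner_comm x]
      exact (innerSL ℝ x).hasFDerivAt
    refine (h1.exp.smul_const (h x)).congr_fderiv ?_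
    ext1 v
    simp [smul_smul]

lemma integrable_exp_smul [IsFiniteMeasure μ] (hμ : IsCompactlySupported μ)
    {h : EucSp n → F} (hh : Continuous h) (ξ : EucSp n) :
    Integrable (fun x => Real.exp ⟪ξ, x⟫ • h x) μ :=
  hμ.integrable (by fun_prop)

lemma ContinuousLinearMap.map_expIntegral [CompleteSpace F] {F' : Type*} [NormedAddCommGroup F']
    [NormedSpace ℝ F'] [CompleteSpace F'] [IsFiniteMeasure μ] (hμ : IsCompactlySupported μ)
    (L : F →L[ℝ] F') {h : EucSp n → F} (hh : Continuous h) (ξ : EucSp n) :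
    L (expIntegral μ h ξ) = expIntegral μ (fun x => L (h x)) ξ := by
  simp only [expIntegral]
  rw [← L.integral_comp_comm (integrable_exp_smul hμ hh ξ)]
  simp

lemma expIntegral_one_pos [IsProbabilityMeasure μ] (hμ : IsCompactlySupported μ) (ξ : EucSp n) :
    0 < expIntegral μ (fun _ => (1 : ℝ)) ξ := by
  have := integrable_exp_smul hμ (continuous_const (y := (1 : ℝ))) ξ
  simp only [expIntegral, smul_eq_mul, mul_one] at this ⊢
  exact integral_exp_pos this

lemma logLaplace_eq (μ : Measure (EucSp n)) (ξ : EucSp n) :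
    logLaplace μ ξ = Real.log (expIntegral μ (fun _ => (1 : ℝ)) ξ) := by
  simp [logLaplace, expIntegral]

end ExponentialIntegrals

section TiltedMoments

variable {n : ℕ} {μ : Measure (EucSp n)}

/-- The barycenter of the probability measure with density proportional to `exp ⟪ξ, x⟫`
with respect to `μ`. -/
def tiltedMean (μ : Measure (EucSp n)) (ξ : EucSp n) : EucSp n :=
  (expIntegral μ (fun _ => (1 : ℝ)) ξ)⁻¹ • expIntegral μ (fun x => x) ξ

/-- The covariance operator of the probability measure with density proportional to
`exp ⟪ξ, x⟫` with respect to `μ`. -/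
def tiltedCov (μ : Measure (EucSp n)) (ξ : EucSp n) : EucSp n →L[ℝ] EucSp n :=
  (expIntegral μ (fun _ => (1 : ℝ)) ξ)⁻¹ • expIntegral μ (fun x => (innerSL ℝ x).smulRight x) ξ -
    (innerSL ℝ (tiltedMean μ ξ)).smulRight (tiltedMean μ ξ)

variable [IsProbabilityMeasure μ]

lemma hasFDerivAt_expIntegral_one (hμ : IsCompactlySupported μ) (ξ : EucSp n) :
    HasFDerivAt (expIntegral μ (fun _ => (1 : ℝ)))
      (innerSL ℝ (expIntegral μ (fun x => x) ξ)) ξ := by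
  refine (hasFDerivAt_expIntegral hμ (continuous_const (y := (1 : ℝ))) ξ).congr_fderiv ?_
  rw [(innerSL ℝ).map_expIntegral hμ continuous_id']
  congr 1
  ext x v
  simp [innerSL_apply_apply ℝ x v]

lemma hasFDerivAt_logLaplace (hμ : IsCompactlySupported μ) (ξ : EucSp n) :
    HasFDerivAt (logLaplace μ) (innerSL ℝ (tiltedMean μ ξ)) ξ := by
  have h := (hasFDerivAt_expIntegral_one hμ ξ).log (expIntegral_one_pos hμ ξ).ne'
  rw [funext (logLaplace_eq μ)]
  refine h.congr_fderiv ?_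
  simp [tiltedMean]

lemma hasFDerivAt_tiltedMean (hμ : IsCompactlySupported μ) (ξ : EucSp n) :
    HasFDerivAt (tiltedMean μ) (tiltedCov μ ξ) ξ := by
  refine (((hasDerivAt_inv (expIntegral_one_pos hμ ξ).ne').comp_hasFDerivAt ξ
    (hasFDerivAt_expIntegral_one hμ ξ)).smul
      (hasFDerivAt_expIntegral hμ continuous_id' ξ)).congr_fderiv ?_
  ext1 v
  simp [tiltedCov, tiltedMean, smul_smul, sub_eq_add_neg]
  congr 1
  ring

lemma inner_tiltedMean (hμ : IsCompactlySupported μ) (ξ v : EucSp n) :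
    ⟪tiltedMean μ ξ, v⟫ = (expIntegral μ (fun _ => (1 : ℝ)) ξ)⁻¹ *
      expIntegral μ (fun x => ⟪x, v⟫) ξ := by
  have := ContinuousLinearMap.map_expIntegral hμ (innerSL ℝ v) continuous_id' ξ
  simp only [innerSL_apply_apply] at this
  rw [tiltedMean, inner_smul_left, real_inner_comm, this]
  simp [real_inner_comm]

lemma inner_tiltedCov (hμ : IsCompactlySupported μ) (ξ v w : EucSp n) :
    ⟪tiltedCov μ ξ v, w⟫ = (expIntegral μ (fun _ => (1 : ℝ)) ξ)⁻¹ *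
      expIntegral μ (fun x => ⟪x, v⟫ * ⟪x, w⟫) ξ - ⟪tiltedMean μ ξ, v⟫ * ⟪tiltedMean μ ξ, w⟫ := by
  have := ContinuousLinearMap.map_expIntegral hμ
    ((innerSL ℝ w).comp (ContinuousLinearMap.apply ℝ (EucSp n) v))
    (h := fun x => (innerSL ℝ x).smulRight x) (by fun_prop) ξ
  simp only [ContinuousLinearMap.comp_apply, ContinuousLinearMap.apply_apply,
    innerSL_apply_apply, ContinuousLinearMap.smulRight_apply, inner_smul_right] at this
  rw [tiltedCov, _root_.sub_apply, inner_sub_left, _root_.smul_apply,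
    inner_smul_left, real_inner_comm, this]
  simp [real_inner_comm, inner_smul_left]

lemma inner_tiltedCov_self (hμ : IsCompactlySupported μ) (ξ v : EucSp n) :
    ⟪tiltedCov μ ξ v, v⟫ = (expIntegral μ (fun _ => (1 : ℝ)) ξ)⁻¹ *
      expIntegral μ (fun x => (⟪x, v⟫ - ⟪tiltedMean μ ξ, v⟫) ^ 2) ξ := by
  have hZ := (expIntegral_one_pos hμ ξ).ne'
  set c := ⟪tiltedMean μ ξ, v⟫ with hc
  have hexpand : expIntegral μ (fun x => (⟪x, v⟫ - c) ^ 2) ξ =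
      expIntegral μ (fun x => ⟪x, v⟫ * ⟪x, v⟫) ξ - (2 * c) * expIntegral μ (fun x => ⟪x, v⟫) ξ
        + c ^ 2 * expIntegral μ (fun _ => (1 : ℝ)) ξ := by
    simp only [expIntegral]
    rw [← integral_const_mul, ← integral_const_mul, ← integral_sub, ← integral_add]
    · congr 1
      ext x
      simp only [smul_eq_mul]
      ring
    all_goals exact hμ.integrable (by fun_prop)
  have hm := inner_tiltedMean hμ ξ v
  rw [← hc] at hm
  rw [inner_tiltedCov hμ, ← hc, hexpand]
  field_simp at hm ⊢
  linear_combination (-2 * c) * hm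

lemma inner_tiltedCov_self_nonneg (hμ : IsCompactlySupported μ) (ξ v : EucSp n) :
    0 ≤ ⟪tiltedCov μ ξ v, v⟫ := by
  rw [inner_tiltedCov_self hμ]
  have := expIntegral_one_pos hμ ξ
  refine mul_nonneg (by positivity) (integral_nonneg fun x => ?_)
  simp only [Pi.zero_apply, smul_eq_mul]
  positivity

lemma inner_tiltedCov_self_pos (hμ : IsCompactlySupported μ) (hhyp : SuppNotInHyperplane μ)
    (ξ : EucSp n) {v : EucSp n} (hv : v ≠ 0) : 0 < ⟪tiltedCov μ ξ v, v⟫ := by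
  refine (inner_tiltedCov_self_nonneg hμ ξ v).lt_of_ne' fun h0 => hhyp ?_
  rw [inner_tiltedCov_self hμ, mul_eq_zero, inv_eq_zero,
    or_iff_right (expIntegral_one_pos hμ ξ).ne', expIntegral, integral_eq_zero_iff_of_nonneg
      (fun x => by simp only [Pi.zero_apply, smul_eq_mul]; positivity)
      (hμ.integrable (by fun_prop))] at h0
  refine ⟨v, ⟪tiltedMean μ ξ, v⟫, hv, msupport_subset_of_isClosed
    (isClosed_eq (by fun_prop) (by fun_prop)) ?_⟩
  filter_upwards [h0] with x hx
  simpa [sub_eq_zero, real_inner_comm v] using hx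

lemma tiltedCov_isPositive (hμ : IsCompactlySupported μ) (ξ : EucSp n) :
    (tiltedCov μ ξ : EucSp n →ₗ[ℝ] EucSp n).IsPositive := by
  refine ⟨fun v w => ?_, fun v => ?_⟩
  · simp only [ContinuousLinearMap.coe_coe]
    rw [real_inner_comm _ v, inner_tiltedCov hμ, inner_tiltedCov hμ]
    simp only [mul_comm]
  · simpa using inner_tiltedCov_self_nonneg hμ ξ v

lemma hessianM_logLaplace (hμ : IsCompactlySupported μ) (ξ : EucSp n) :
    hessianM (logLaplace μ) ξ =
      (LinearMap.toMatrix (EuclideanSpace.basisFun (Fin n) ℝ).toBasis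
        (EuclideanSpace.basisFun (Fin n) ℝ).toBasis (tiltedCov μ ξ)).transpose := by
  ext i j
  have h (η : EucSp n) : fderiv ℝ (logLaplace μ) η (EuclideanSpace.single j 1) =
      tiltedMean μ η j := by
    rw [(hasFDerivAt_logLaplace hμ η).fderiv]
    simp [EuclideanSpace.inner_single_right]
  have h' : HasFDerivAt (fun η => tiltedMean μ η j)
      ((EuclideanSpace.proj j).comp (tiltedCov μ ξ)) ξ :=
    (EuclideanSpace.proj (𝕜 := ℝ) j).hasFDerivAt.comp ξ (hasFDerivAt_tiltedMean hμ ξ)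
  simp only [hessianM, Matrix.of_apply, h, h'.fderiv]
  simp [LinearMap.toMatrix_apply]

lemma det_hessianM_logLaplace (hμ : IsCompactlySupported μ) (ξ : EucSp n) :
    (hessianM (logLaplace μ) ξ).det = (tiltedCov μ ξ).det := by
  rw [hessianM_logLaplace hμ, Matrix.det_transpose, LinearMap.det_toMatrix,
    ContinuousLinearMap.det]

lemma det_tiltedCov_nonneg (hμ : IsCompactlySupported μ) (ξ : EucSp n) :
    0 ≤ (tiltedCov μ ξ).det := by
  rw [ContinuousLinearMap.det, ← LinearMap.det_toMatrix
    (EuclideanSpace.basisFun (Fin n) ℝ).toBasis]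
  exact ((LinearMap.posSemidef_toMatrix_iff _).2 (tiltedCov_isPositive hμ ξ)).det_nonneg

lemma measurable_det_hessianM (f : EucSp n → ℝ) : Measurable fun ξ => (hessianM f ξ).det := by
  simp only [Matrix.det_apply]
  refine Finset.measurable_sum _ fun σ _ => .const_smul (Finset.measurable_prod _ fun i _ => ?_) _
  exact measurable_fderiv_apply_const ℝ _ _

lemma injective_tiltedMean (hμ : IsCompactlySupported μ) (hhyp : SuppNotInHyperplane μ) :
    Function.Injective (tiltedMean μ) := by
  intro ξ η h
  by_contra hne
  have hv : ξ - η ≠ 0 := sub_ne_zero.2 hne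
  have hd (t : ℝ) : HasDerivAt (fun t : ℝ => ⟪tiltedMean μ (η + t • (ξ - η)), ξ - η⟫)
      ⟪tiltedCov μ (η + t • (ξ - η)) (ξ - η), ξ - η⟫ t := by
    have h1 : HasDerivAt (fun t : ℝ => η + t • (ξ - η)) (ξ - η) t := by
      simpa using ((hasDerivAt_id t).smul_const (ξ - η)).const_add η
    have h2 := (hasFDerivAt_tiltedMean hμ (η + t • (ξ - η))).comp_hasDerivAt t h1
    simpa using h2.inner ℝ (hasDerivAt_const t (ξ - η))
  have hmono := strictMono_of_hasDerivAt_pos hd fun t => inner_tiltedCov_self_pos hμ hhyp _ hv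
  have := hmono zero_lt_one
  simp [h] at this

lemma tiltedMean_mem_closure (hμ : IsCompactlySupported μ) (ξ : EucSp n) :
    tiltedMean μ ξ ∈ closure (convexHull ℝ (msupport μ)) := by
  have hint : Integrable (fun x => Real.exp ⟪ξ, x⟫) μ := hμ.integrable (by fun_prop)
  have := isProbabilityMeasure_tilted hint
  have hmean : tiltedMean μ ξ = ∫ x, x ∂(μ.tilted fun x => ⟪ξ, x⟫) := by
    rw [integral_tilted]
    simp only [tiltedMean, expIntegral, ← integral_smul, smul_smul, smul_eq_mul, mul_one]
    simp only [div_eq_inv_mul]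
  rw [hmean]
  refine (convex_convexHull ℝ _).closure.integral_mem isClosed_closure ?_ ?_
  · refine (tilted_absolutelyContinuous μ _).ae_le ?_
    filter_upwards [ae_mem_msupport μ] with x hx
    exact subset_closure (subset_convexHull ℝ _ hx)
  · rw [integrable_tilted_iff hint]
    exact hμ.integrable (by fun_prop)

lemma exists_pos_le_integral_posPart_inner (hμ : IsCompactlySupported μ) {y : EucSp n}
    (hy : y ∈ interior (convexHull ℝ (msupport μ))) :
    ∃ c > 0, ∀ ξ : EucSp n, c * ‖ξ‖ ≤ ∫ x, max ⟪ξ, x - y⟫ 0 ∂μ := by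
  set Φ : EucSp n → ℝ := fun ξ => ∫ x, max ⟪ξ, x - y⟫ 0 ∂μ with hΦ
  have hΦc : Continuous Φ := by
    obtain ⟨K, hK, h⟩ := hμ.exists_restrict_eq
    have := continuous_parametric_integral_of_continuous (μ := μ)
      (f := fun ξ x : EucSp n => max ⟪ξ, x - y⟫ 0) (by unfold Function.uncurry; fun_prop) hK
    rwa [h] at this
  have hΦpos (θ : EucSp n) (hθ : θ ≠ 0) : 0 < Φ θ := by
    refine (integral_nonneg fun x => le_max_right _ _).lt_of_ne' fun h0 => ?_
    rw [integral_eq_zero_iff_of_nonneg (fun x => le_max_right _ _)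
      (hμ.integrable (f := fun x => max ⟪θ, x - y⟫ 0) (by fun_prop))] at h0
    have hsub : convexHull ℝ (msupport μ) ⊆ {x | ⟪θ, x⟫ ≤ ⟪θ, y⟫} := by
      refine convexHull_min (msupport_subset_of_isClosed
        (isClosed_le (by fun_prop) (by fun_prop)) ?_) (convex_halfSpace_le
          (innerSL ℝ θ).isLinear _)
      filter_upwards [h0] with x hx
      simpa [inner_sub_right] using hx
    have hlim : Tendsto (fun t : ℝ => y + t • θ) (𝓝[>] 0) (𝓝 y) := by
      have : Continuous fun t : ℝ => y + t • θ := by fun_prop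
      simpa using (this.tendsto 0).mono_left nhdsWithin_le_nhds
    obtain ⟨t, ht, ht0⟩ := ((hlim.eventually (mem_interior_iff_mem_nhds.1 hy)).and
      self_mem_nhdsWithin).exists
    have h1 : ⟪θ, y + t • θ⟫ ≤ ⟪θ, y⟫ := hsub ht
    rw [inner_add_right, inner_smul_right, add_le_iff_nonpos_right] at h1
    have h2 : 0 < ⟪θ, θ⟫ := real_inner_self_pos.2 hθ
    exact (mul_pos ht0 h2).not_ge h1
  have hhom (ξ : EucSp n) : Φ ξ = ‖ξ‖ * Φ (‖ξ‖⁻¹ • ξ) := by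
    simp only [hΦ]
    rcases eq_or_ne ξ 0 with rfl | hξ
    · simp
    rw [← integral_const_mul]
    congr 1
    ext x
    rw [inner_smul_left, mul_max_of_nonneg _ _ (norm_nonneg _)]
    have := norm_ne_zero_iff.2 hξ
    simp [this]
  rcases (Metric.sphere (0 : EucSp n) 1).eq_empty_or_nonempty with he | hne
  · refine ⟨1, one_pos, fun ξ => ?_⟩
    have hξ : ξ = 0 := by
      by_contra hξ
      have : ‖ξ‖⁻¹ • ξ ∈ Metric.sphere (0 : EucSp n) 1 := by
        simp [norm_smul, norm_ne_zero_iff.2 hξ]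
      simp [he] at this
    simp [hξ]
  · obtain ⟨θ, hθ, hmin⟩ := (isCompact_sphere (0 : EucSp n) 1).exists_isMinOn hne hΦc.continuousOn
    refine ⟨Φ θ, hΦpos θ (ne_zero_of_mem_unit_sphere ⟨θ, hθ⟩), fun ξ => ?_⟩
    rcases eq_or_ne ξ 0 with rfl | hξ
    · simp
    change Φ θ * ‖ξ‖ ≤ Φ ξ
    rw [hhom ξ, mul_comm]
    gcongr
    exact hmin (by simp [norm_smul, norm_ne_zero_iff.2 hξ])

lemma interior_subset_range_tiltedMean (hμ : IsCompactlySupported μ) :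
    interior (convexHull ℝ (msupport μ)) ⊆ range (tiltedMean μ) := by
  intro y hy
  obtain ⟨c, hc, hle⟩ := exists_pos_le_integral_posPart_inner hμ hy
  have hder (ξ : EucSp n) : HasFDerivAt (fun ξ => logLaplace μ ξ - ⟪y, ξ⟫)
      (innerSL ℝ (tiltedMean μ ξ) - innerSL ℝ y) ξ :=
    (hasFDerivAt_logLaplace hμ ξ).sub (innerSL ℝ y).hasFDerivAt
  have hcont : Continuous fun ξ => logLaplace μ ξ - ⟪y, ξ⟫ :=
    continuous_iff_continuousAt.2 fun ξ => (hder ξ).continuousAt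
  have hlower (ξ : EucSp n) (hξ : ξ ≠ 0) :
      Real.log (c * ‖ξ‖) ≤ logLaplace μ ξ - ⟪y, ξ⟫ := by
    rw [Real.log_le_iff_le_exp (by positivity), Real.exp_sub, logLaplace_eq,
      Real.exp_log (expIntegral_one_pos hμ ξ), div_eq_mul_inv, ← Real.exp_neg, expIntegral,
      ← integral_mul_const]
    refine (hle ξ).trans (integral_mono (hμ.integrable (by fun_prop))
      (hμ.integrable (by fun_prop)) fun x => ?_)
    simp only [smul_eq_mul, mul_one]
    rw [← Real.exp_add, ← sub_eq_add_neg, real_inner_comm ξ y, ← inner_sub_right]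
    exact max_le ((lt_add_one _).le.trans (Real.add_one_le_exp _)) (Real.exp_pos _).le
  have htend : Tendsto (fun ξ => logLaplace μ ξ - ⟪y, ξ⟫) (cocompact (EucSp n)) atTop := by
    have h1 : Tendsto (fun ξ : EucSp n => Real.log (c * ‖ξ‖)) (cocompact (EucSp n)) atTop :=
      Real.tendsto_log_atTop.comp ((tendsto_norm_cocompact_atTop (E := EucSp n)).const_mul_atTop hc)
    refine tendsto_atTop_mono' _ ?_ h1
    filter_upwards [(isCompact_singleton (x := (0 : EucSp n))).compl_mem_cocompact] with ξ hξ
    exact hlower ξ hξ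
  obtain ⟨ξ, hmin⟩ := hcont.exists_forall_le htend
  have h0 := IsLocalMin.hasFDerivAt_eq_zero (Eventually.of_forall hmin) (hder ξ)
  refine ⟨ξ, ?_⟩
  rw [← map_sub] at h0
  exact sub_eq_zero.1 (norm_eq_zero.1 (by rw [← innerSL_apply_norm ℝ, h0, norm_zero]))

lemma volume_range_tiltedMean (hμ : IsCompactlySupported μ) :
    volume (range (tiltedMean μ)) = volume (interior (convexHull ℝ (msupport μ))) := by
  refine le_antisymm ?_ (measure_mono (interior_subset_range_tiltedMean hμ))
  rw [measure_congr (interior_ae_eq_of_null_frontier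
    ((convex_convexHull ℝ (msupport μ)).addHaar_frontier volume)),
    ← measure_congr (closure_ae_eq_of_null_frontier
    ((convex_convexHull ℝ (msupport μ)).addHaar_frontier volume))]
  exact measure_mono (range_subset_iff.2 (tiltedMean_mem_closure hμ))

end TiltedMoments

/-- For a compactly-supported Borel probability measure μ on ℝⁿ whose support is not
contained in a hyperplane, with K the interior of the convex hull of the support of μ,
∫ det ∇²Λ_μ(ξ) dξ = Vol_n(K). -/
theorem integral_det_hessian_logLaplace (n : ℕ) (μ : Measure (EucSp n))
    (hprob : IsProbabilityMeasure μ) (hcpt : IsCompactlySupported μ)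
    (hhyp : SuppNotInHyperplane μ) :
    ∫ ξ : EucSp n, (hessianM (logLaplace μ) ξ).det =
      (volume (interior (convexHull ℝ (msupport μ)))).toReal := by
  have hnonneg (ξ : EucSp n) : 0 ≤ (hessianM (logLaplace μ) ξ).det := by
    rw [det_hessianM_logLaplace hcpt]
    exact det_tiltedCov_nonneg hcpt ξ
  rw [integral_eq_lintegral_of_nonneg_ae (Eventually.of_forall hnonneg)
    (measurable_det_hessianM _).aestronglyMeasurable, ← volume_range_tiltedMean hcpt,
    ← image_univ, ← lintegral_abs_det_fderiv_eq_addHaar_image volume MeasurableSet.univ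
      (fun ξ _ => (hasFDerivAt_tiltedMean hcpt ξ).hasFDerivWithinAt)
      (injective_tiltedMean hcpt hhyp).injOn, Measure.restrict_univ]
  simp only [det_hessianM_logLaplace hcpt, abs_of_nonneg (det_tiltedCov_nonneg hcpt _)]
end
end
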